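/- Let Q be a quasivariety and suppose that A ∈ Q_RFSI is a substructure of some B ∈ Q. Then there exists a meet-irreducible Φ ∈ Con_Q B such that Φ ∩ (A×A) = Δ_A, and consequently there exist C ∈ Q_RFSI and a surjective homomorphism φ : B → C such that ker φ ∩ (A×A) = Δ_A. -/

import Mathlib

open FirstOrder Language Set

universe u

namespace Transfer

variable (L : FirstOrder.Language.{u, u})

/-- A bundled `L`-structure with carrier in universe `u`. -/
structure Struc : Type (u + 1) where
  Carrier : Type u
  [str : L.Structure Carrier]

attribute [instance] Struc.str

/-- Product structure on a Pi type. -/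
instance piStructure {ι : Type u} (M : ι → Type u) [∀ i, L.Structure (M i)] :
    L.Structure (∀ i, M i) where
  funMap f x i := Structure.funMap f fun j => x j i
  RelMap r x := ∀ i, Structure.RelMap r fun j => x j i

/-- Product structure on a binary product. -/
instance prodStructure (M N : Type u) [L.Structure M] [L.Structure N] :
    L.Structure (M × N) where
  funMap f x := (Structure.funMap f fun j => (x j).1, Structure.funMap f fun j => (x j).2)
  RelMap r x := Structure.RelMap r (fun j => (x j).1) ∧ Structure.RelMap r (fun j => (x j).2)

variable {L}

/-- The bundled structure on a substructure. -/
abbrev ofSub (B : Struc L) (S : L.Substructure B.Carrier) : Struc L := ⟨S⟩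

/-- The kernel of a map, as a set of pairs. -/
def kerSet {α β : Type u} (f : α → β) : Set (α × α) := {p | f p.1 = f p.2}

/-- The restriction of a binary relation on `B` to a substructure `S`. -/
def restrict {B : Struc L} (S : L.Substructure B.Carrier)
    (Θ : Set (B.Carrier × B.Carrier)) : Set ((ofSub B S).Carrier × (ofSub B S).Carrier) :=
  {p | ((p.1 : B.Carrier), (p.2 : B.Carrier)) ∈ Θ}

/-- The image of a binary relation on a substructure `S` in `B`. -/
def lift {B : Struc L} (S : L.Substructure B.Carrier)
    (Θ : Set ((ofSub B S).Carrier × (ofSub B S).Carrier)) : Set (B.Carrier × B.Carrier) :=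
  (fun p => ((p.1 : B.Carrier), (p.2 : B.Carrier))) '' Θ

/-- The set of `Q`-congruences of `A`: kernels of homomorphisms into members of `Q`. -/
def ConQ (Q : Set (Struc L)) (A : Struc L) : Set (Set (A.Carrier × A.Carrier)) :=
  {θ | ∃ M ∈ Q, ∃ f : A.Carrier →[L] M.Carrier, θ = kerSet f}

/-- The least `Q`-congruence of `A` containing `R`. -/
def cgQ (Q : Set (Struc L)) (A : Struc L) (R : Set (A.Carrier × A.Carrier)) :
    Set (A.Carrier × A.Carrier) :=
  ⋂₀ {θ | θ ∈ ConQ Q A ∧ R ⊆ θ}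

/-- The join of two `Q`-congruences in `Con_Q A`. -/
def joinQ (Q : Set (Struc L)) (A : Struc L) (θ φ : Set (A.Carrier × A.Carrier)) :
    Set (A.Carrier × A.Carrier) :=
  cgQ Q A (θ ∪ φ)

/-- `θ` is a meet-irreducible element of `Con_Q A`. -/
def MeetIrred (Q : Set (Struc L)) (A : Struc L) (θ : Set (A.Carrier × A.Carrier)) : Prop :=
  θ ∈ ConQ Q A ∧
    ∀ θ₁ ∈ ConQ Q A, ∀ θ₂ ∈ ConQ Q A, θ = θ₁ ∩ θ₂ → θ = θ₁ ∨ θ = θ₂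

/-- `θ` is a completely meet-irreducible element of `Con_Q A`. -/
def CompletelyMeetIrred (Q : Set (Struc L)) (A : Struc L)
    (θ : Set (A.Carrier × A.Carrier)) : Prop :=
  θ ∈ ConQ Q A ∧
    ∀ S ⊆ ConQ Q A, θ = ⋂₀ S → θ ∈ S

/-- The class of relatively finitely subdirectly irreducible members of `Q`. -/
def RFSI (Q : Set (Struc L)) : Set (Struc L) :=
  {A | A ∈ Q ∧ MeetIrred Q A (Set.diagonal A.Carrier)}

/-- The class of relatively subdirectly irreducible members of `Q`. -/
def RSI (Q : Set (Struc L)) : Set (Struc L) :=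
  {A | A ∈ Q ∧ CompletelyMeetIrred Q A (Set.diagonal A.Carrier)}

/-- `B` has the `Q`-congruence extension property. -/
def HasQCEP (Q : Set (Struc L)) (B : Struc L) : Prop :=
  ∀ S : L.Substructure B.Carrier, ∀ θ ∈ ConQ Q (ofSub B S),
    ∃ Φ ∈ ConQ Q B, restrict S Φ = θ

/-- A class `K` of members of `Q` has the `Q`-congruence extension property. -/
def ClassQCEP (Q K : Set (Struc L)) : Prop :=
  ∀ B ∈ K, HasQCEP Q B

variable (L)

/-- `Q` is a quasivariety: closed under isomorphisms, substructures, direct products,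
and ultraproducts. -/
def IsQuasivariety (Q : Set (Struc L)) : Prop :=
  (∀ A ∈ Q, ∀ B : Struc L, Nonempty (A.Carrier ≃[L] B.Carrier) → B ∈ Q) ∧
  (∀ B ∈ Q, ∀ S : L.Substructure B.Carrier, ofSub B S ∈ Q) ∧
  (∀ (ι : Type u) (f : ι → Struc L), (∀ i, f i ∈ Q) →
    (⟨∀ i, (f i).Carrier⟩ : Struc L) ∈ Q) ∧
  (∀ (ι : Type u) (f : ι → Struc L) (U : Ultrafilter ι), (∀ i, f i ∈ Q) →
    (⟨(U : Filter ι).Product fun i => (f i).Carrier⟩ : Struc L) ∈ Q)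

/-- `V` is a variety: closed under homomorphic images, substructures, and direct products. -/
def IsVariety (V : Set (Struc L)) : Prop :=
  (∀ A ∈ V, ∀ B : Struc L, ∀ f : A.Carrier →[L] B.Carrier, Function.Surjective f → B ∈ V) ∧
  (∀ B ∈ V, ∀ S : L.Substructure B.Carrier, ofSub B S ∈ V) ∧
  (∀ (ι : Type u) (f : ι → Struc L), (∀ i, f i ∈ V) →
    (⟨∀ i, (f i).Carrier⟩ : Struc L) ∈ V)

variable {L}

/-- `Q` is relatively congruence-distributive: `Con_Q A` is a distributive lattice
for every `A ∈ Q`. -/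
def RelCongDist (Q : Set (Struc L)) : Prop :=
  ∀ A ∈ Q, ∀ θ ∈ ConQ Q A, ∀ φ ∈ ConQ Q A, ∀ ψ ∈ ConQ Q A,
    θ ∩ joinQ Q A φ ψ = joinQ Q A (θ ∩ φ) (θ ∩ ψ)

/-- Relation composition `Θ ∘ Φ = {(a,c) : ∃ b, (a,b) ∈ Φ ∧ (b,c) ∈ Θ}`. -/
def relComp {α : Type u} (Θ Φ : Set (α × α)) : Set (α × α) :=
  {p | ∃ b, (p.1, b) ∈ Φ ∧ (b, p.2) ∈ Θ}

/-- `Q` is relatively congruence-permutable. -/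
def RelCongPerm (Q : Set (Struc L)) : Prop :=
  ∀ A ∈ Q, ∀ θ ∈ ConQ Q A, ∀ φ ∈ ConQ Q A, relComp θ φ = relComp φ θ

/-- A class `K` is closed under substructures. -/
def SubClosed (K : Set (Struc L)) : Prop :=
  ∀ B ∈ K, ∀ S : L.Substructure B.Carrier, ofSub B S ∈ K

/-- A class `K` is closed under isomorphisms. -/
def IsoClosed (K : Set (Struc L)) : Prop :=
  ∀ A ∈ K, ∀ B : Struc L, Nonempty (A.Carrier ≃[L] B.Carrier) → B ∈ K

/-- A universal class: closed under isomorphisms, substructures, and ultraproducts. -/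
def IsUniversalClass (K : Set (Struc L)) : Prop :=
  IsoClosed K ∧ SubClosed K ∧
  (∀ (ι : Type u) (f : ι → Struc L) (U : Ultrafilter ι), (∀ i, f i ∈ K) →
    (⟨(U : Filter ι).Product fun i => (f i).Carrier⟩ : Struc L) ∈ K)

/-- The extension property for a class `K`. -/
def HasEP (K : Set (Struc L)) : Prop :=
  ∀ A ∈ K, ∀ B ∈ K, ∀ C ∈ K,
    ∀ (φB : A.Carrier →[L] B.Carrier) (φC : A.Carrier →[L] C.Carrier),
      Function.Injective φB → Function.Surjective φC →
      ∃ D ∈ K, ∃ (ψB : B.Carrier →[L] D.Carrier) (ψC : C.Carrier →[L] D.Carrier),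
        Function.Injective ψC ∧ ∀ a, ψB (φB a) = ψC (φC a)

/-- The one-sided amalgamation property for a class `K`. -/
def Has1AP (K : Set (Struc L)) : Prop :=
  ∀ A ∈ K, ∀ B ∈ K, ∀ C ∈ K,
    ∀ (φB : A.Carrier →[L] B.Carrier) (φC : A.Carrier →[L] C.Carrier),
      Function.Injective φB → Function.Injective φC →
      ∃ D ∈ K, ∃ (ψB : B.Carrier →[L] D.Carrier) (ψC : C.Carrier →[L] D.Carrier),
        Function.Injective ψC ∧ ∀ a, ψB (φB a) = ψC (φC a)

/-- Every doubly injective span in `K` has an amalgam in `K'`. -/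
def HasAmalgamIn (K K' : Set (Struc L)) : Prop :=
  ∀ A ∈ K, ∀ B ∈ K, ∀ C ∈ K,
    ∀ (φB : A.Carrier →[L] B.Carrier) (φC : A.Carrier →[L] C.Carrier),
      Function.Injective φB → Function.Injective φC →
      ∃ D ∈ K', ∃ (ψB : B.Carrier →[L] D.Carrier) (ψC : C.Carrier →[L] D.Carrier),
        Function.Injective ψB ∧ Function.Injective ψC ∧ ∀ a, ψB (φB a) = ψC (φC a)

/-- The amalgamation property for a class `K`. -/
def HasAP (K : Set (Struc L)) : Prop := HasAmalgamIn K K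

/-- The transferable injections property for a class `K`. -/
def HasTIP (K : Set (Struc L)) : Prop :=
  ∀ A ∈ K, ∀ B ∈ K, ∀ C ∈ K,
    ∀ (φB : A.Carrier →[L] B.Carrier) (φC : A.Carrier →[L] C.Carrier),
      Function.Injective φB →
      ∃ D ∈ K, ∃ (ψB : B.Carrier →[L] D.Carrier) (ψC : C.Carrier →[L] D.Carrier),
        Function.Injective ψC ∧ ∀ a, ψB (φB a) = ψC (φC a)

/-- Every doubly injective span in `K` has a strong amalgam in `K'`. -/
def HasStrongAmalgamIn (K K' : Set (Struc L)) : Prop :=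
  ∀ A ∈ K, ∀ B ∈ K, ∀ C ∈ K,
    ∀ (φB : A.Carrier →[L] B.Carrier) (φC : A.Carrier →[L] C.Carrier),
      Function.Injective φB → Function.Injective φC →
      ∃ D ∈ K', ∃ (ψB : B.Carrier →[L] D.Carrier) (ψC : C.Carrier →[L] D.Carrier),
        Function.Injective ψB ∧ Function.Injective ψC ∧ (∀ a, ψB (φB a) = ψC (φC a)) ∧
        Set.range (fun a => ψB (φB a)) = Set.range ψB ∩ Set.range ψC

/-- The strong amalgamation property for a class `K`. -/
def HasSAP (K : Set (Struc L)) : Prop := HasStrongAmalgamIn K K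

/-- `φ : A → B` is an epimorphism in the class `K`. -/
def IsEpiIn (K : Set (Struc L)) {A B : Struc L} (φ : A.Carrier →[L] B.Carrier) : Prop :=
  ∀ C ∈ K, ∀ ψ₁ ψ₂ : B.Carrier →[L] C.Carrier,
    ψ₁.comp φ = ψ₂.comp φ → ψ₁ = ψ₂

/-- The class `K` has surjective epimorphisms. -/
def HasSE (K : Set (Struc L)) : Prop :=
  ∀ A ∈ K, ∀ B ∈ K, ∀ φ : A.Carrier →[L] B.Carrier,
    IsEpiIn K φ → Function.Surjective φ

/-- A substructure `S` of `B` is a retract of `B`. -/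
def IsRetract (B : Struc L) (S : L.Substructure B.Carrier) : Prop :=
  ∃ ψ : B.Carrier →[L] (ofSub B S).Carrier, ∀ a : (ofSub B S).Carrier, ψ (a : B.Carrier) = a


/-- The smallest variety containing `V₁ ∪ V₂`. -/
def varJoin (L : FirstOrder.Language.{u, u}) (V₁ V₂ : Set (Struc L)) : Set (Struc L) :=
  ⋂₀ {W | IsVariety L W ∧ V₁ ⊆ W ∧ V₂ ⊆ W}

/-- The union of a nonempty chain of `Q`-congruences is a `Q`-congruence. -/
theorem sUnion_mem_ConQ [L.IsAlgebraic] {Q : Set (Struc L)} (hQ : IsQuasivariety L Q)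
    {B : Struc L} {c : Set (Set (B.Carrier × B.Carrier))} (hc : c ⊆ ConQ Q B)
    (hchain : IsChain (· ⊆ ·) c) (hne : c.Nonempty) : ⋃₀ c ∈ ConQ Q B := by
  have hrep (θ : c) : ∃ M ∈ Q, ∃ f : B.Carrier →[L] M.Carrier, θ.1 = kerSet f := hc θ.2
  choose M hM f hf using hrep
  have : Nonempty c := hne.to_subtype
  have : IsDirectedOrder c := ⟨fun a b => (hchain.total a.2 b.2).elim
    (fun h => ⟨b, h, le_rfl⟩) fun h => ⟨a, le_rfl, h⟩⟩
  let U : Ultrafilter c := Ultrafilter.of Filter.atTop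
  have hU : (U : Filter c) ≤ Filter.atTop := Ultrafilter.of_le _
  let g : B.Carrier →[L] (U : Filter c).Product fun θ => (M θ).Carrier :=
    { toFun := fun b => Quotient.mk ((U : Filter c).productSetoid _) fun θ => f θ b
      map_fun' := fun F x => by
        refine Eq.trans ?_ (Ultraproduct.funMap_cast F fun i θ => f θ (x i)).symm
        exact congrArg (Quotient.mk _) (funext fun θ => (f θ).map_fun F x)
      map_rel' := fun r => isEmptyElim r }
  refine ⟨_, hQ.2.2.2 c M U hM, g, ?_⟩
  ext ⟨a, b⟩
  have hg : (a, b) ∈ kerSet g ↔ ∀ᶠ θ in (U : Filter c), f θ a = f θ b :=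
    Quotient.eq (r := (U : Filter c).productSetoid fun θ => (M θ).Carrier)
  have hmem (θ : c) : f θ a = f θ b ↔ (a, b) ∈ θ.1 := by rw [hf θ]; rfl
  simp only [hg, hmem, Set.mem_sUnion]
  constructor
  · rintro ⟨θ, hθ, hab⟩
    exact ((Filter.eventually_ge_atTop (⟨θ, hθ⟩ : c)).filter_mono hU).mono fun _ hle => hle hab
  · intro h
    obtain ⟨θ, hθ⟩ := h.exists
    exact ⟨θ.1, θ.2, hθ⟩

/-- Every member of `Q` has the diagonal as a `Q`-congruence. -/
theorem diagonal_mem_ConQ {Q : Set (Struc L)} {B : Struc L} (hB : B ∈ Q) :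
    Set.diagonal B.Carrier ∈ ConQ Q B :=
  ⟨B, hB, Hom.id L B.Carrier, rfl⟩

/-- Pulling a `Q`-congruence back along a homomorphism yields a `Q`-congruence. -/
theorem preimage_mem_ConQ {Q : Set (Struc L)} {B C : Struc L} (φ : B.Carrier →[L] C.Carrier)
    {θ : Set (C.Carrier × C.Carrier)} (hθ : θ ∈ ConQ Q C) :
    Prod.map φ φ ⁻¹' θ ∈ ConQ Q B := by
  obtain ⟨M, hM, f, rfl⟩ := hθ
  exact ⟨M, hM, f.comp φ, rfl⟩

/-- The restriction of a `Q`-congruence to a substructure is a `Q`-congruence. -/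
theorem restrict_mem_ConQ {Q : Set (Struc L)} {B : Struc L} (S : L.Substructure B.Carrier)
    {θ : Set (B.Carrier × B.Carrier)} (hθ : θ ∈ ConQ Q B) :
    restrict S θ ∈ ConQ Q (ofSub B S) :=
  preimage_mem_ConQ (B := ofSub B S) S.subtype.toHom hθ

/-- Every `Q`-congruence is reflexive. -/
theorem diagonal_subset_of_mem_ConQ {Q : Set (Struc L)} {B : Struc L}
    {θ : Set (B.Carrier × B.Carrier)} (hθ : θ ∈ ConQ Q B) :
    Set.diagonal B.Carrier ⊆ θ := by
  obtain ⟨M, -, f, rfl⟩ := hθ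
  rintro ⟨a, b⟩ hab
  exact congrArg f hab

/-- A meet-irreducible diagonal of a substructure is the restriction of a meet-irreducible
`Q`-congruence. -/
theorem exists_meetIrred_restrict_eq_diagonal [L.IsAlgebraic] {Q : Set (Struc L)}
    (hQ : IsQuasivariety L Q) {B : Struc L} (hB : B ∈ Q) (S : L.Substructure B.Carrier)
    (hS : MeetIrred Q (ofSub B S) (Set.diagonal (ofSub B S).Carrier)) :
    ∃ Φ, MeetIrred Q B Φ ∧ restrict S Φ = Set.diagonal (ofSub B S).Carrier := by
  obtain ⟨Φ, -, hΦ⟩ := zorn_subset_nonempty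
    {θ | θ ∈ ConQ Q B ∧ restrict S θ = Set.diagonal (ofSub B S).Carrier}
    (fun c hc hchain hne => by
      have hun : ⋃₀ c ∈ ConQ Q B := sUnion_mem_ConQ hQ (fun θ hθ => (hc hθ).1) hchain hne
      refine ⟨⋃₀ c, ⟨hun, Set.Subset.antisymm ?_ ?_⟩, fun θ hθ => Set.subset_sUnion_of_mem hθ⟩
      · rintro p ⟨θ, hθ, hp⟩
        exact (hc hθ).2.subset hp
      · exact diagonal_subset_of_mem_ConQ (restrict_mem_ConQ S hun))
    (Set.diagonal B.Carrier)
    ⟨diagonal_mem_ConQ hB, by ext ⟨a, b⟩; exact Subtype.ext_iff.symm⟩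
  refine ⟨Φ, ⟨hΦ.prop.1, fun θ₁ h₁ θ₂ h₂ heq => ?_⟩, hΦ.prop.2⟩
  refine (hS.2 _ (restrict_mem_ConQ S h₁) _ (restrict_mem_ConQ S h₂) ?_).imp (fun h => ?_)
    fun h => ?_
  · rw [← hΦ.prop.2, heq]
    rfl
  · exact hΦ.eq_of_subset ⟨h₁, h.symm⟩ (heq.subset.trans Set.inter_subset_left)
  · exact hΦ.eq_of_subset ⟨h₂, h.symm⟩ (heq.subset.trans Set.inter_subset_right)

/-- A structure in `Q` is relatively finitely subdirectly irreducible if it is the image of a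
homomorphism with meet-irreducible kernel. -/
theorem mem_RFSI_of_meetIrred_kerSet {Q : Set (Struc L)} {B C : Struc L} (hC : C ∈ Q)
    (φ : B.Carrier →[L] C.Carrier) (hφ : Function.Surjective φ)
    (hker : MeetIrred Q B (kerSet φ)) : C ∈ RFSI Q := by
  have hinj : Function.Injective (Set.preimage (Prod.map φ φ)) :=
    (hφ.prodMap hφ).preimage_injective
  refine ⟨hC, diagonal_mem_ConQ hC, fun θ₁ h₁ θ₂ h₂ heq => ?_⟩
  refine (hker.2 _ (preimage_mem_ConQ φ h₁) _ (preimage_mem_ConQ φ h₂) ?_).imp (fun h => hinj h)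
    fun h => hinj h
  rw [← Set.preimage_inter, ← heq]
  rfl

/-- Every `Q`-congruence is the kernel of a surjective homomorphism onto a member of `Q`. -/
theorem exists_surjective_of_mem_ConQ {Q : Set (Struc L)} (hQ : IsQuasivariety L Q)
    {B : Struc L} {θ : Set (B.Carrier × B.Carrier)} (hθ : θ ∈ ConQ Q B) :
    ∃ C ∈ Q, ∃ φ : B.Carrier →[L] C.Carrier, Function.Surjective φ ∧ kerSet φ = θ := by
  obtain ⟨M, hM, f, rfl⟩ := hθ
  refine ⟨ofSub M f.range, hQ.2.1 M hM _, f.codRestrict f.range f.mem_range_self, ?_, ?_⟩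
  · rintro ⟨_, b, rfl⟩
    exact ⟨b, rfl⟩
  · ext ⟨a, b⟩
    exact Subtype.ext_iff

/-- Corollary 2.7: if `A ∈ Q_RFSI` is a substructure of `B ∈ Q`, then there is a
meet-irreducible `Φ ∈ Con_Q B` with `Φ ∩ (A×A) = Δ_A`, and consequently `C ∈ Q_RFSI` and a
surjective homomorphism `φ : B → C` with `ker φ ∩ (A×A) = Δ_A`. -/
theorem stmt6 (L : FirstOrder.Language.{u, u}) [L.IsAlgebraic]
    (Q : Set (Struc L)) (hQ : IsQuasivariety L Q) (B : Struc L) (hB : B ∈ Q)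
    (S : L.Substructure B.Carrier) (hA : ofSub B S ∈ RFSI Q) :
    (∃ Φ, MeetIrred Q B Φ ∧ restrict S Φ = Set.diagonal (ofSub B S).Carrier) ∧
    (∃ C ∈ RFSI Q, ∃ φ : B.Carrier →[L] C.Carrier, Function.Surjective φ ∧
      restrict S (kerSet ⇑φ) = Set.diagonal (ofSub B S).Carrier) := by
  obtain ⟨Φ, hΦ, hres⟩ := exists_meetIrred_restrict_eq_diagonal hQ hB S hA.2
  obtain ⟨C, hC, φ, hφ, rfl⟩ := exists_surjective_of_mem_ConQ hQ hΦ.1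
  exact ⟨⟨_, hΦ, hres⟩, C, mem_RFSI_of_meetIrred_kerSet hC φ hφ hΦ, φ, hφ, hres⟩

end Transfer
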